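/- arXiv:2301.05066 — 2 statements merged into one kernel-verified Lean document; each statement's English description precedes it below -/
import Mathlib

section
/- For every m ≥ 1 and all indices j, k ∈ {1,…,m}, the operator X_{jk} := x_j∂_{x_k} − y_k∂_{y_j} − z_k∂_{z_j} − (1/2)δ_{jk}·id commutes with the symplectic Dirac operator: [D_s, X_{jk}] = 0. -/
open MvPolynomial Finset

noncomputable section

/-- Polynomials in 3m variables x_1..x_m, y_1..y_m, z_1..z_m. -/
abbrev PS (m : ℕ) : Type := MvPolynomial (Fin m ⊕ Fin m ⊕ Fin m) ℂ

variable (m : ℕ)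

/-- partial derivative ∂_{x_j} -/
def dx (j : Fin m) : Module.End ℂ (PS m) := (pderiv (Sum.inl j)).toLinearMap
/-- partial derivative ∂_{y_j} -/
def dy (j : Fin m) : Module.End ℂ (PS m) := (pderiv (Sum.inr (Sum.inl j))).toLinearMap
/-- partial derivative ∂_{z_j} -/
def dz (j : Fin m) : Module.End ℂ (PS m) := (pderiv (Sum.inr (Sum.inr j))).toLinearMap
/-- multiplication by x_j -/
def mx (j : Fin m) : Module.End ℂ (PS m) := LinearMap.mulLeft ℂ (X (Sum.inl j))
/-- multiplication by y_j -/
def my (j : Fin m) : Module.End ℂ (PS m) := LinearMap.mulLeft ℂ (X (Sum.inr (Sum.inl j)))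
/-- multiplication by z_j -/
def mz (j : Fin m) : Module.End ℂ (PS m) := LinearMap.mulLeft ℂ (X (Sum.inr (Sum.inr j)))

/-- symplectic Dirac operator D_s = ⟨z,∂_y⟩ − ⟨∂_z,∂_x⟩ -/
def Ds : Module.End ℂ (PS m) := (∑ j, mz m j * dy m j) - ∑ j, dz m j * dx m j
/-- adjoint X_s = ⟨y,∂_z⟩ + ⟨x,z⟩ -/
def Xs : Module.End ℂ (PS m) := (∑ j, my m j * dz m j) + ∑ j, mx m j * mz m j
/-- Euler operator in x -/
def Ex : Module.End ℂ (PS m) := ∑ j, mx m j * dx m j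
/-- Euler operator in y -/
def Ey : Module.End ℂ (PS m) := ∑ j, my m j * dy m j
/-- Euler operator in z -/
def Ez : Module.End ℂ (PS m) := ∑ j, mz m j * dz m j
/-- Δ_x -/
def lapX : Module.End ℂ (PS m) := ∑ j, dx m j * dx m j
/-- Δ_y -/
def lapY : Module.End ℂ (PS m) := ∑ j, dy m j * dy m j
/-- Δ_z -/
def lapZ : Module.End ℂ (PS m) := ∑ j, dz m j * dz m j
/-- ⟨∂_x,∂_y⟩ -/
def dxdy : Module.End ℂ (PS m) := ∑ j, dx m j * dy m j
/-- ⟨∂_y,∂_z⟩ -/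
def dydz : Module.End ℂ (PS m) := ∑ j, dy m j * dz m j
/-- ⟨∂_x,∂_z⟩ = ⟨∂_z,∂_x⟩ -/
def dxdz : Module.End ℂ (PS m) := ∑ j, dx m j * dz m j
/-- ⟨x,∂_y⟩ -/
def xdy : Module.End ℂ (PS m) := ∑ j, mx m j * dy m j
/-- ⟨y,∂_x⟩ -/
def ydx : Module.End ℂ (PS m) := ∑ j, my m j * dx m j
/-- ⟨x,∂_z⟩ -/
def xdz : Module.End ℂ (PS m) := ∑ j, mx m j * dz m j
/-- ⟨z,∂_x⟩ -/
def zdx : Module.End ℂ (PS m) := ∑ j, mz m j * dx m j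
/-- ⟨y,∂_z⟩ -/
def ydz : Module.End ℂ (PS m) := ∑ j, my m j * dz m j
/-- ⟨z,∂_y⟩ -/
def zdy : Module.End ℂ (PS m) := ∑ j, mz m j * dy m j
/-- multiplication by |x|² -/
def nx2 : Module.End ℂ (PS m) := ∑ j, mx m j * mx m j
/-- multiplication by |y|² -/
def ny2 : Module.End ℂ (PS m) := ∑ j, my m j * my m j
/-- multiplication by |z|² -/
def nz2 : Module.End ℂ (PS m) := ∑ j, mz m j * mz m j
/-- multiplication by ⟨x,y⟩ -/
def mxy : Module.End ℂ (PS m) := ∑ j, mx m j * my m j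
/-- multiplication by ⟨y,z⟩ -/
def myz : Module.End ℂ (PS m) := ∑ j, my m j * mz m j
/-- multiplication by ⟨x,z⟩ -/
def mxz : Module.End ℂ (PS m) := ∑ j, mx m j * mz m j
/-- L = ⟨x,∂_y⟩ − (1/2)Δ_z -/
def Lop : Module.End ℂ (PS m) := xdy m - (1/2 : ℂ) • lapZ m
/-- R = ⟨y,∂_x⟩ + (1/2)|z|² -/
def Rop : Module.End ℂ (PS m) := ydx m + (1/2 : ℂ) • nz2 m

/-- X_{jk} := x_j∂_{x_k} − y_k∂_{y_j} − z_k∂_{z_j} − (1/2)δ_{jk}·id -/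
def Xjk (j k : Fin m) : Module.End ℂ (PS m) :=
  mx m j * dx m k - my m k * dy m j - mz m k * dz m j -
    (if j = k then (1/2 : ℂ) else 0) • 1

theorem pderiv_pderiv_comm {σ R : Type*} [CommRing R] (i j : σ) (p : MvPolynomial σ R) :
    pderiv i (pderiv j p) = pderiv j (pderiv i p) := by
  classical
  have h : ⁅(pderiv i : Derivation R (MvPolynomial σ R) (MvPolynomial σ R)),
      (pderiv j : Derivation R (MvPolynomial σ R) (MvPolynomial σ R))⁆ = 0 := by
    refine derivation_ext fun k => ?_
    simp [Derivation.commutator_apply, Pi.single_apply, apply_ite]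
  have hp := congrArg (fun D : Derivation R (MvPolynomial σ R) (MvPolynomial σ R) => D p) h
  simpa [Derivation.commutator_apply, sub_eq_zero] using hp

theorem lie_mz_dy_sub_dz_dx_Xjk_apply {m : ℕ} (i j k : Fin m) (p : PS m) :
    ⁅mz m i * dy m i - dz m i * dx m i, Xjk m j k⁆ p =
      (if i = j then mz m k (dy m j p) - dz m j (dx m k p) else 0) -
        (if i = k then mz m k (dy m j p) - dz m j (dx m k p) else 0) := by
  rw [Ring.lie_def, Xjk]
  generalize (if j = k then (1 / 2 : ℂ) else 0) = c
  simp only [mx, my, mz, dx, dy, dz, LinearMap.sub_apply, Module.End.mul_apply,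
    LinearMap.smul_apply, Module.End.one_apply, LinearMap.mulLeft_apply, Derivation.map_sub,
    Derivation.map_add, pderiv_C, Derivation.coeFn_coe, pderiv_mul, pderiv_X,
    Pi.single_apply, Sum.inl.injEq, Sum.inr.injEq, reduceCtorEq, if_false, zero_mul, zero_add,
    ite_mul, one_mul, smul_eq_C_mul, eq_comm (b := i)]
  by_cases hij : i = j
  · subst hij
    by_cases hik : i = k
    · subst hik
      simp only [if_true, pderiv_pderiv_comm]
      ring
    · simp only [hik, if_true, if_false, pderiv_pderiv_comm]
      ring
  · by_cases hik : i = k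
    · subst hik
      simp only [hij, if_true, if_false, Derivation.map_zero, pderiv_pderiv_comm]
      ring
    · simp only [hij, hik, if_false, Derivation.map_zero, pderiv_pderiv_comm]
      ring

/-- [D_s, X_{jk}] = 0. -/
theorem stmt2 : ∀ m : ℕ, 1 ≤ m → ∀ j k : Fin m, ⁅Ds m, Xjk m j k⁆ = 0 := by
  intro m _ j k
  refine LinearMap.ext fun p => ?_
  rw [Ds, ← Finset.sum_sub_distrib, Ring.lie_def, Finset.sum_mul, Finset.mul_sum,
    ← Finset.sum_sub_distrib, LinearMap.sum_apply]
  simp [← Ring.lie_def, lie_mz_dy_sub_dz_dx_Xjk_apply]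
end
end

section
/- For every m ≥ 1 and all indices a, b ∈ {1,…,m}, the symplectic Dirac operator D_s and its adjoint X_s commute with every total angular momentum operator L_{ab} := (x_a∂_{x_b} − x_b∂_{x_a}) + (y_a∂_{y_b} − y_b∂_{y_a}) + (z_a∂_{z_b} − z_b∂_{z_a}): [D_s, L_{ab}] = 0 and [X_s, L_{ab}] = 0. -/
open MvPolynomial Finset

noncomputable section

variable (m : ℕ)

/-- angular momentum operator L_{ab} acting diagonally on the three sets of variables -/
def Lab (a b : Fin m) : Module.End ℂ (PS m) :=
  (mx m a * dx m b - mx m b * dx m a) + (my m a * dy m b - my m b * dy m a) +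
    (mz m a * dz m b - mz m b * dz m a)

/-- Partial derivatives of polynomials commute. -/
theorem pderiv_comm_apply {R σ : Type*} [CommRing R] (i j : σ) (p : MvPolynomial σ R) :
    pderiv i (pderiv j p) = pderiv j (pderiv i p) := by
  classical
  have h : ⁅pderiv (R := R) i, pderiv (R := R) j⁆ = 0 := by
    refine MvPolynomial.derivation_ext fun k => ?_
    simp only [Derivation.commutator_apply, pderiv_X, Pi.single_apply]
    split_ifs <;> simp
  have := DFunLike.congr_fun h p
  rwa [Derivation.commutator_apply, Derivation.zero_apply, sub_eq_zero] at this

/-- A family of operators transforms as a vector under `ad L` for the infinitesimal rotation `L`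
in the `(a, b)`-plane. -/
def TransformsAsVector {A ι : Type*} [Ring A] [DecidableEq ι] (L : A) (a b : ι) (u : ι → A) :
    Prop :=
  ∀ j, ⁅u j, L⁆ = (if j = a then u b else 0) - (if j = b then u a else 0)

/-- The pairing of two vector families is rotation invariant. -/
theorem TransformsAsVector.commute_sum_mul {A ι : Type*} [Ring A] [Fintype ι] [DecidableEq ι]
    {L : A} {a b : ι} {u v : ι → A} (hu : TransformsAsVector L a b u)
    (hv : TransformsAsVector L a b v) : Commute (∑ j, u j * v j) L := by
  have h : ∀ j, u j * v j * L - L * (u j * v j) = u j * ⁅v j, L⁆ + ⁅u j, L⁆ * v j := fun j => by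
    simp only [Ring.lie_def]; noncomm_ring
  rw [commute_iff_eq, ← sub_eq_zero, sum_mul, mul_sum, ← sum_sub_distrib]
  simp only [h, hu _, hv _, mul_sub, sub_mul, mul_ite, ite_mul, mul_zero, zero_mul,
    sum_add_distrib, sum_sub_distrib, sum_ite_eq', mem_univ, if_true]
  abel

theorem transformsAsVector_mx (a b : Fin m) : TransformsAsVector (Lab m a b) a b (mx m) := by
  intro j
  refine LinearMap.ext fun p => ?_
  simp only [Ring.lie_def, Lab, mx, my, mz, dx, dy, dz]
  split_ifs <;> simp_all [Derivation.leibniz, pderiv_X] <;> ring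

theorem transformsAsVector_my (a b : Fin m) : TransformsAsVector (Lab m a b) a b (my m) := by
  intro j
  refine LinearMap.ext fun p => ?_
  simp only [Ring.lie_def, Lab, mx, my, mz, dx, dy, dz]
  split_ifs <;> simp_all [Derivation.leibniz, pderiv_X] <;> ring

theorem transformsAsVector_mz (a b : Fin m) : TransformsAsVector (Lab m a b) a b (mz m) := by
  intro j
  refine LinearMap.ext fun p => ?_
  simp only [Ring.lie_def, Lab, mx, my, mz, dx, dy, dz]
  split_ifs <;> simp_all [Derivation.leibniz, pderiv_X] <;> ring

theorem transformsAsVector_dx (a b : Fin m) : TransformsAsVector (Lab m a b) a b (dx m) := by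
  intro j
  refine LinearMap.ext fun p => ?_
  simp only [Ring.lie_def, Lab, mx, my, mz, dx, dy, dz]
  simp only [LinearMap.sub_apply, LinearMap.add_apply, Module.End.mul_apply,
    LinearMap.mulLeft_apply, Derivation.coeFn_coe, map_sub, map_add, Derivation.leibniz,
    pderiv_comm_apply (Sum.inl j), smul_eq_mul]
  split_ifs <;> simp_all [pderiv_X]

theorem transformsAsVector_dy (a b : Fin m) : TransformsAsVector (Lab m a b) a b (dy m) := by
  intro j
  refine LinearMap.ext fun p => ?_
  simp only [Ring.lie_def, Lab, mx, my, mz, dx, dy, dz]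
  simp only [LinearMap.sub_apply, LinearMap.add_apply, Module.End.mul_apply,
    LinearMap.mulLeft_apply, Derivation.coeFn_coe, map_sub, map_add, Derivation.leibniz,
    pderiv_comm_apply (Sum.inr (Sum.inl j)), smul_eq_mul]
  split_ifs <;> simp_all [pderiv_X]

theorem transformsAsVector_dz (a b : Fin m) : TransformsAsVector (Lab m a b) a b (dz m) := by
  intro j
  refine LinearMap.ext fun p => ?_
  simp only [Ring.lie_def, Lab, mx, my, mz, dx, dy, dz]
  simp only [LinearMap.sub_apply, LinearMap.add_apply, Module.End.mul_apply,
    LinearMap.mulLeft_apply, Derivation.coeFn_coe, map_sub, map_add, Derivation.leibniz,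
    pderiv_comm_apply (Sum.inr (Sum.inr j)), smul_eq_mul]
  split_ifs <;> simp_all [pderiv_X]

/-- [D_s, L_{ab}] = 0 and [X_s, L_{ab}] = 0. -/
theorem stmt13 : ∀ m : ℕ, 1 ≤ m → ∀ a b : Fin m,
    ⁅Ds m, Lab m a b⁆ = 0 ∧ ⁅Xs m, Lab m a b⁆ = 0 := by
  intro m _ a b
  have hx := transformsAsVector_mx m a b
  have hy := transformsAsVector_my m a b
  have hz := transformsAsVector_mz m a b
  have hdx := transformsAsVector_dx m a b
  have hdy := transformsAsVector_dy m a b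
  have hdz := transformsAsVector_dz m a b
  exact ⟨commute_iff_lie_eq.mp ((hz.commute_sum_mul hdy).sub_left (hdz.commute_sum_mul hdx)),
    commute_iff_lie_eq.mp ((hy.commute_sum_mul hdz).add_left (hx.commute_sum_mul hz))⟩
end
end
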